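/- Fix an integer n ≥ 1 and a real α > 0, and define the complex-valued polar components V^r(r,θ) = i·n·(J_n(αr) − J_n(α)·r^n)/(α²·r)·e^{inθ} and V^θ(r,θ) = (α·(J_{n+1}(αr) − J_{n−1}(αr)) + 2n·J_n(α)·r^{n−1})/(2α²)·e^{inθ} for r > 0 and θ ∈ ℝ. Then the polar scalar curl equals a pure Bessel mode: (1/r)·∂_r(r·V^θ(r,θ)) − (1/r)·∂_θ V^r(r,θ) = J_n(αr)·e^{inθ}. -/

import Mathlib

open Real MeasureTheory intervalIntegral

/-- The Bessel function of the first kind of (integer) order `n`, defined by its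
everywhere-convergent power series. -/
noncomputable def besselJ (n : ℕ) (x : ℝ) : ℝ :=
  ∑' m : ℕ, ((-1 : ℝ) ^ m / (Nat.factorial m * Nat.factorial (m + n))) * (x / 2) ^ (2 * m + n)

/-- `x` is the `k`-th positive zero of `f` (for `k ≥ 1`): `x` is a positive zero of `f`
and there are exactly `k - 1` positive zeros of `f` below `x`. -/
def IsKthPosZero (f : ℝ → ℝ) (k : ℕ) (x : ℝ) : Prop :=
  0 < x ∧ f x = 0 ∧ {y : ℝ | 0 < y ∧ y < x ∧ f y = 0}.ncard = k - 1

/-- Auxiliary entire function: `J_n(x) = (x/2)^n F_n((x/2)^2)`. -/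
noncomputable def besF (n : ℕ) (y : ℝ) : ℝ :=
  ∑' m : ℕ, ((-1 : ℝ) ^ m / (Nat.factorial m * Nat.factorial (m + n))) * y ^ m

lemma besselJ_eq (n : ℕ) (x : ℝ) : besselJ n x = (x / 2) ^ n * besF n ((x / 2) ^ 2) := by
  unfold besselJ besF
  rw [← tsum_mul_left]
  congr 1; ext m
  rw [pow_add, pow_mul]; ring

lemma coef_bound (n m : ℕ) :
    |(-1 : ℝ) ^ m / (Nat.factorial m * Nat.factorial (m + n))| ≤ 1 / (Nat.factorial m : ℝ) := by
  rw [abs_div, abs_pow, abs_neg, abs_one, one_pow, abs_of_pos (by positivity)]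
  have h1 : (1 : ℝ) ≤ Nat.factorial (m + n) := by exact_mod_cast Nat.factorial_pos _
  have h0 : (0 : ℝ) < Nat.factorial m := by positivity
  apply one_div_le_one_div_of_le h0
  nlinarith

lemma besF_summable (n : ℕ) (y : ℝ) :
    Summable fun m : ℕ => ((-1 : ℝ) ^ m / (Nat.factorial m * Nat.factorial (m + n))) * y ^ m := by
  refine Summable.of_norm_bounded (Real.summable_pow_div_factorial |y|) fun m => ?_
  rw [Real.norm_eq_abs, abs_mul, abs_pow]
  calc _ ≤ 1 / (Nat.factorial m : ℝ) * |y| ^ m := by gcongr; exact coef_bound n m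
    _ = _ := by ring

lemma besF_deriv (n : ℕ) (y : ℝ) : HasDerivAt (besF n) (-besF (n + 1) y) y := by
  have hs : Summable fun m : ℕ => (1 / (Nat.factorial m : ℝ)) * (m * (|y| + 1) ^ (m - 1)) := by
    rw [← summable_nat_add_iff 1]
    refine (Real.summable_pow_div_factorial (|y| + 1)).congr fun m => ?_
    rw [Nat.factorial_succ, Nat.add_sub_cancel]
    push_cast
    field_simp
  have hd := hasDerivAt_tsum_of_isPreconnected (t := Metric.ball (0 : ℝ) (|y| + 1))
    (g := fun (m : ℕ) (y : ℝ) =>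
      ((-1 : ℝ) ^ m / (Nat.factorial m * Nat.factorial (m + n))) * y ^ m)
    (g' := fun (m : ℕ) (y : ℝ) =>
      ((-1 : ℝ) ^ m / (Nat.factorial m * Nat.factorial (m + n))) * (m * y ^ (m - 1)))
    (y₀ := y) (y := y) hs Metric.isOpen_ball (convex_ball _ _).isPreconnected
    (fun m z _ => (hasDerivAt_pow m z).const_mul _)
    (fun m z hz => by
      have hz' : |z| ≤ |y| + 1 := by
        have := mem_ball_zero_iff.1 hz
        rw [Real.norm_eq_abs] at this
        exact this.le
      rw [Real.norm_eq_abs, abs_mul, abs_mul, abs_pow, Nat.abs_cast]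
      gcongr
      exact coef_bound n m)
    (by simp) (besF_summable n y) (by simp)
  refine HasDerivAt.congr_deriv hd ?_
  symm
  rw [tsum_eq_zero_add']
  · unfold besF
    rw [← tsum_neg]
    simp only [Nat.cast_zero, zero_mul, mul_zero, zero_add]
    congr 1; ext m
    rw [Nat.add_sub_cancel, Nat.factorial_succ, show m + 1 + n = m + (n + 1) by ring, pow_succ]
    push_cast
    field_simp
  · refine (besF_summable (n + 1) y).neg.congr fun m => ?_
    rw [Nat.add_sub_cancel, Nat.factorial_succ, show m + 1 + n = m + (n + 1) by ring, pow_succ]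
    push_cast
    field_simp

lemma besF_rec (n : ℕ) (y : ℝ) :
    besF n y = (n + 1) * besF (n + 1) y - y * besF (n + 2) y := by
  have h : (n + 1) * besF (n + 1) y - besF n y = y * besF (n + 2) y := by
    unfold besF
    rw [← tsum_mul_left, ← Summable.tsum_sub ((besF_summable (n+1) y).mul_left _)
      (besF_summable n y), ← tsum_mul_left, Summable.tsum_eq_zero_add]
    · have h0 : ∀ m : ℕ, (Nat.factorial (m + (n + 1)) : ℝ) =
          (m + n + 1) * Nat.factorial (m + n) := fun m => by
        rw [← add_assoc, Nat.factorial_succ]; push_cast; ring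
      rw [show ∀ a b c : ℝ, a = 0 → b = c → a + b = c by intro a b c h1 h2; linarith]
      · have := h0 0
        simp only [zero_add, Nat.cast_zero] at this
        simp only [zero_add, this, Nat.factorial_zero, pow_zero]
        push_cast
        field_simp
        ring
      · congr 1; ext m
        have e1 : m + 1 + (n + 1) = m + (n + 2) := by ring
        have e2 := h0 (m + 1)
        rw [e1] at e2 ⊢
        rw [e2, Nat.factorial_succ, pow_succ, pow_succ]
        push_cast
        field_simp
        ring
    · exact ((besF_summable (n+1) y).mul_left _).sub (besF_summable n y)
  linarith

lemma besselJ_hasDeriv (n : ℕ) (x : ℝ) : HasDerivAt (besselJ n)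
    (n * (x / 2) ^ (n - 1) * (1 / 2) * besF n ((x / 2) ^ 2)
      + (x / 2) ^ n * (-besF (n + 1) ((x / 2) ^ 2) * (x / 2))) x := by
  have hx : HasDerivAt (fun x : ℝ => x / 2) (1 / 2) x := (hasDerivAt_id x).div_const 2
  have h2 : HasDerivAt (fun x : ℝ => (x / 2) ^ 2) (x / 2) x := by
    refine HasDerivAt.congr_deriv (hx.pow 2) ?_
    norm_num
    ring
  have h3 := (hx.pow n).mul ((besF_deriv n ((x / 2) ^ 2)).comp x h2)
  rw [show besselJ n = fun x => (x / 2) ^ n * besF n ((x / 2) ^ 2) from funext (besselJ_eq n)]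
  exact h3

/-- Bessel's equation in first-order form. -/
lemma bessel_key (k : ℕ) (x : ℝ) (hx : 0 < x) :
    HasDerivAt (fun x => x * (besselJ (k + 2) x - besselJ k x))
      (2 * x * besselJ (k + 1) x - 2 * (k + 1) ^ 2 / x * besselJ (k + 1) x) x := by
  have h := (hasDerivAt_id x).mul ((besselJ_hasDeriv (k + 2) x).sub (besselJ_hasDeriv k x))
  refine h.congr_deriv ?_
  simp only [besselJ_eq, Pi.sub_apply, id, one_mul]
  have r1 := besF_rec k ((x / 2) ^ 2)
  have r2 := besF_rec (k + 1) ((x / 2) ^ 2)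
  have hk : (k : ℝ) * (x / 2) ^ (k - 1) = k * (x / 2) ^ k * (2 / x) := by
    rcases k with _ | k
    · simp
    · rw [Nat.add_sub_cancel, pow_succ]; field_simp
  rw [hk, show k + 2 - 1 = k + 1 by omega]
  push_cast at r1 r2 ⊢
  have r3 : (x/2)^2 * besF (k + 2 + 1) ((x / 2) ^ 2) =
      (k + 2) * besF (k + 2) ((x / 2) ^ 2) - besF (k + 1) ((x / 2) ^ 2) := by
    rw [show k + 2 + 1 = k + 1 + 2 by ring]; linarith
  rw [r1]
  simp only [show k + 1 + 1 = k + 2 by ring] at *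
  generalize besF (k + 2 + 1) ((x / 2) ^ 2) = A at *
  generalize besF (k + 2) ((x / 2) ^ 2) = B at *
  generalize besF (k + 1) ((x / 2) ^ 2) = C at *
  obtain ⟨z, rfl⟩ : ∃ z, x = 2 * z := ⟨x / 2, by ring⟩
  have hz : z ≠ 0 := by rintro rfl; simp at hx
  rw [show 2 * z / 2 = z by ring] at *
  have r4 : A = ((k + 2) * B - C) / z ^ 2 := by rw [← r3]; field_simp
  rw [r4]
  simp only [pow_add]
  field_simp
  ring

/-- The scalar curl of the Stokes eigenfunction velocity field on the disk is a pure
Bessel mode: with radial component `Vr` and tangential component `Vθ` as below, the polar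
curl `(1/r) ∂_r (r Vθ) - (1/r) ∂_θ Vr` equals `J_n(α r) e^{i n θ}` for all `r > 0` and `θ`. -/
theorem stokes_eigenfunction_curl (n : ℕ) (hn : 1 ≤ n) (α : ℝ) (hα : 0 < α)
    (Vr Vθ : ℝ → ℝ → ℂ)
    (hVr : ∀ r θ, Vr r θ = Complex.I * (n : ℂ) *
      (((besselJ n (α * r) - besselJ n α * r ^ n) / (α ^ 2 * r) : ℝ) : ℂ) *
        Complex.exp (Complex.I * (n : ℂ) * (θ : ℂ)))
    (hVθ : ∀ r θ, Vθ r θ = (((α * (besselJ (n + 1) (α * r) - besselJ (n - 1) (α * r)) +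
        2 * (n : ℝ) * besselJ n α * r ^ (n - 1)) / (2 * α ^ 2) : ℝ) : ℂ) *
        Complex.exp (Complex.I * (n : ℂ) * (θ : ℂ))) :
    ∀ (r θ : ℝ), 0 < r →
      (1 / (r : ℂ)) * deriv (fun s : ℝ => (s : ℂ) * Vθ s θ) r -
        (1 / (r : ℂ)) * deriv (fun t : ℝ => Vr r t) θ =
          ((besselJ n (α * r) : ℝ) : ℂ) * Complex.exp (Complex.I * (n : ℂ) * (θ : ℂ)) := by
  intro r θ hr
  obtain ⟨k, rfl⟩ : ∃ k, n = k + 1 := ⟨n - 1, by omega⟩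
  have hr' : (r : ℂ) ≠ 0 := by exact_mod_cast hr.ne'
  have hα' : (α : ℂ) ≠ 0 := by exact_mod_cast hα.ne'
  have hkey := (bessel_key k (α * r) (by positivity)).comp r ((hasDerivAt_id r).const_mul α)
  have hreal := ((hkey.add ((hasDerivAt_pow (k + 1) r).const_mul
    (2 * ((k : ℝ) + 1) * besselJ (k + 1) α))).div_const (2 * α ^ 2)).ofReal_comp.mul_const
    (Complex.exp (Complex.I * ((k + 1 : ℕ) : ℂ) * (θ : ℂ)))
  have hθ : HasDerivAt (fun t : ℝ => Complex.exp (Complex.I * ((k + 1 : ℕ) : ℂ) * (t : ℂ)))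
      (Complex.exp (Complex.I * ((k + 1 : ℕ) : ℂ) * (θ : ℂ)) *
        (Complex.I * ((k + 1 : ℕ) : ℂ))) θ := by
    have := ((hasDerivAt_id θ).ofReal_comp.const_mul (Complex.I * ((k + 1 : ℕ) : ℂ))).cexp
    simpa using this
  have hf : (fun s : ℝ => (s : ℂ) * Vθ s θ) = fun s : ℝ => (((α * s * (besselJ (k + 2) (α * s) -
      besselJ k (α * s)) + 2 * ((k : ℝ) + 1) * besselJ (k + 1) α * s ^ (k + 1)) /
      (2 * α ^ 2) : ℝ) : ℂ) * Complex.exp (Complex.I * ((k + 1 : ℕ) : ℂ) * (θ : ℂ)) := by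
    funext s
    rw [hVθ, Nat.add_sub_cancel]
    push_cast
    ring
  have hg : (fun t : ℝ => Vr r t) = _ := funext (hVr r)
  rw [hf, hg, (hθ.const_mul _).deriv]
  erw [hreal.deriv]
  rw [Nat.add_sub_cancel]
  push_cast
  generalize Complex.exp _ = E
  have hI : Complex.I ^ 2 = -1 := Complex.I_sq
  field_simp
  rw [hI]
  ring
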